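/- Let d, C be positive natural numbers with C ≥ 2, let h map each point of ℝ^d (with the Euclidean norm) to a probability vector on Fin C, let y_i ≠ y_j be distinct classes in Fin C, and let K > 0 and J > 0 be real numbers. Suppose |h_{y_i}(x) − h_{y_i}(z)| ≤ K‖x − z‖₂ for all x, z ∈ ℝ^d, that ‖x_i − x_j‖₂ ≤ 1/(J·K), and that h_{y_i}(x_i) > 1/2 + 1/J. Then the empirical 0-1 loss of h on the two-example dataset {(x_i, y_i), (x_j, y_j)} equals 1/2: the indicator 1[h_{y_i}(x_i) < max_{c ≠ y_i} h_c(x_i)] equals 0 and the indicator 1[h_{y_j}(x_j) < max_{c ≠ y_j} h_c(x_j)] equals 1. -/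

import Mathlib

open Finset

/-- `maxOther hC f y` is `max_{c ≠ y} f c`, the largest predicted score among the
classes different from `y` (well-defined since `C ≥ 2`). -/
noncomputable def maxOther {C : ℕ} (hC : 2 ≤ C) (f : Fin C → ℝ) (y : Fin C) : ℝ :=
  (Finset.univ.filter (fun c => c ≠ y)).sup'
    (by
      obtain ⟨c, hc⟩ := Fintype.exists_ne_of_one_lt_card (by rw [Fintype.card_fin]; exact hC) y
      exact ⟨c, by simp [hc]⟩) f

/-- Two distinct coordinates of a probability vector sum to at most one. -/
theorem add_le_one_of_sum_eq_one {ι : Type*} [Fintype ι] {p : ι → ℝ}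
    (hp : ∀ c, 0 ≤ p c) (hsum : ∑ c, p c = 1) {a b : ι} (hab : a ≠ b) : p a + p b ≤ 1 := by
  classical
  rw [← hsum, ← Finset.sum_pair hab]
  exact Finset.sum_le_sum_of_subset_of_nonneg (Finset.subset_univ _) fun c _ _ => hp c

theorem le_maxOther {C : ℕ} (hC : 2 ≤ C) (f : Fin C → ℝ) {c y : Fin C} (hc : c ≠ y) :
    f c ≤ maxOther hC f y :=
  Finset.le_sup' f (by simp [hc])

theorem maxOther_le {C : ℕ} (hC : 2 ≤ C) (f : Fin C → ℝ) {y : Fin C} {a : ℝ}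
    (ha : ∀ c, c ≠ y → f c ≤ a) : maxOther hC f y ≤ a :=
  Finset.sup'_le _ f fun c hc => ha c (by simpa using hc)

/-- Cases I/II of the single-classifier risk analysis in Theorem 5.1: a classifier whose
coordinate `y_i` is `K`-Lipschitz and which confidently classifies `x_i` into `y_i`
(score `> 1/2 + 1/J`) correctly classifies `x_i` (indicator `0`) and misclassifies the
neighbouring example `x_j` (indicator `1`), so its empirical 0-1 loss on the two-example
dataset `{(x_i, y_i), (x_j, y_j)}` equals `1/2`. -/
theorem single_classifier_loss_on_ambiguous_pair
    (d C : ℕ) (hd : 0 < d) (hC : 2 ≤ C)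
    (h : EuclideanSpace ℝ (Fin d) → Fin C → ℝ)
    (hpos : ∀ x c, 0 ≤ h x c) (hsum : ∀ x, ∑ c, h x c = 1)
    (yi yj : Fin C) (hy : yi ≠ yj)
    (K J : ℝ) (hK : 0 < K) (hJ : 0 < J)
    (hLip : ∀ x z : EuclideanSpace ℝ (Fin d), |h x yi - h z yi| ≤ K * ‖x - z‖)
    (xi xj : EuclideanSpace ℝ (Fin d))
    (hdist : ‖xi - xj‖ ≤ 1 / (J * K))
    (hconf : h xi yi > 1 / 2 + 1 / J) :
    (¬ h xi yi < maxOther hC (h xi) yi) ∧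
    (h xj yj < maxOther hC (h xj) yj) ∧
    ((if h xi yi < maxOther hC (h xi) yi then (1 : ℝ) else 0) +
      (if h xj yj < maxOther hC (h xj) yj then (1 : ℝ) else 0)) / 2 = 1 / 2 := by
  have hJinv : 0 < 1 / J := by positivity
  have hclose : h xi yi - h xj yi ≤ 1 / J :=
    calc h xi yi - h xj yi ≤ K * ‖xi - xj‖ := (le_abs_self _).trans (hLip xi xj)
      _ ≤ K * (1 / (J * K)) := by gcongr
      _ = 1 / J := by field_simp
  have hcorrect : ¬ h xi yi < maxOther hC (h xi) yi := by
    refine not_lt.mpr (maxOther_le hC _ fun c hc => ?_)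
    linarith [add_le_one_of_sum_eq_one (hpos xi) (hsum xi) hc]
  have hwrong : h xj yj < maxOther hC (h xj) yj := by
    linarith [add_le_one_of_sum_eq_one (hpos xj) (hsum xj) hy, le_maxOther hC (h xj) hy]
  refine ⟨hcorrect, hwrong, ?_⟩
  rw [if_neg hcorrect, if_pos hwrong, zero_add]
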